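/- For the primal–dual iterates with data b^δ, for every (x, y) ∈ X × Y and every k ≥ 0: V(z_{k+1} − z) − V(z_k − z) + ((1 − τ_M L)/(2τ_M))‖x_{k+1} − x_k‖² + ½‖y_{k+1} − y_k‖_Σ² + [L_{b^δ}(x_{k+1}, y) − L_{b^δ}(x, y_{k+1})] + ⟨y_{k+1} − ỹ_k, A(x − x_{k+1})⟩ ≤ ε_{k+1}, where z = (x, y) and z_k = (x_k, y_k). -/

import Mathlib

open scoped RealInnerProductSpace ENNReal NNReal
open Filter Topology

noncomputable section

/-- The `ε`-subdifferential of an extended-real-valued function `R` at `x`: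
`∂_ε R (x) = {u : ∀ x', R x - R x' ≤ ⟪u, x - x'⟫ + ε}`, written without `EReal` subtraction. -/
def epsSubdiff {X : Type*} [NormedAddCommGroup X] [InnerProductSpace ℝ X]
    (R : X → EReal) (ε : ℝ) (x : X) : Set X :=
  {u | ∀ x' : X, R x + ((⟪u, x' - x⟫ - ε : ℝ) : EReal) ≤ R x'}

/-- Convexity for extended-real-valued functions. -/
def ERealConvex {X : Type*} [AddCommGroup X] [Module ℝ X] (R : X → EReal) : Prop :=
  ∀ x y : X, ∀ t : ℝ, 0 ≤ t → t ≤ 1 →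
    R (t • x + (1 - t) • y) ≤ (t : EReal) * R x + ((1 - t : ℝ) : EReal) * R y

/-- `R` is proper, convex and lower semicontinuous. -/
def ProperConvexLsc {X : Type*} [NormedAddCommGroup X] [InnerProductSpace ℝ X]
    (R : X → EReal) : Prop :=
  (∃ x, R x ≠ ⊤) ∧ (∀ x, R x ≠ ⊥) ∧ ERealConvex R ∧ LowerSemicontinuous R

/-- The Lagrangian `L_b(x,y) = R x + F x + ⟪y, A x - b⟫`. -/
def Lag {X Y : Type*} [NormedAddCommGroup X] [InnerProductSpace ℝ X]
    [NormedAddCommGroup Y] [InnerProductSpace ℝ Y]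
    (R : X → EReal) (F : X → ℝ) (A : X →L[ℝ] Y) (b : Y) (x : X) (y : Y) : EReal :=
  R x + ((F x + ⟪y, A x - b⟫ : ℝ) : EReal)

/-- Saddle points of the Lagrangian `L_b`. -/
def IsSaddle {X Y : Type*} [NormedAddCommGroup X] [InnerProductSpace ℝ X]
    [NormedAddCommGroup Y] [InnerProductSpace ℝ Y]
    (R : X → EReal) (F : X → ℝ) (A : X →L[ℝ] Y) (b : Y) (p : X × Y) : Prop :=
  ∀ x : X, ∀ y : Y, Lag R F A b p.1 y ≤ Lag R F A b x p.2

/-- Weak convergence of a sequence in a Hilbert space. -/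
def WeakTendsto {X : Type*} [NormedAddCommGroup X] [InnerProductSpace ℝ X]
    (u : ℕ → X) (l : X) : Prop :=
  ∀ w : X, Tendsto (fun k => ⟪u k, w⟫) atTop (nhds ⟪l, w⟫)

/-- `V(x,y) = ½‖x‖_T² + ½‖y‖_Σ²`, written via the inverses of the preconditioners. -/
def Vfun {X Y : Type*} [NormedAddCommGroup X] [InnerProductSpace ℝ X]
    [NormedAddCommGroup Y] [InnerProductSpace ℝ Y]
    (Tinv : X →L[ℝ] X) (Sginv : Y →L[ℝ] Y) (z : X × Y) : ℝ :=
  1 / 2 * ⟪Tinv z.1, z.1⟫ + 1 / 2 * ⟪Sginv z.2, z.2⟫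

variable {X Y : Type*}
  [NormedAddCommGroup X] [InnerProductSpace ℝ X] [CompleteSpace X]
  [NormedAddCommGroup Y] [InnerProductSpace ℝ Y] [CompleteSpace Y]

theorem HasGradientAt.hasDerivAt_comp_add_smul {F : X → ℝ} {g u v : X} {t : ℝ}
    (h : HasGradientAt F g (u + t • v)) :
    HasDerivAt (fun s : ℝ => F (u + s • v)) ⟪g, v⟫ t := by
  have hline : HasDerivAt (fun s : ℝ => u + s • v) v t := by
    simpa using ((hasDerivAt_id t).smul_const v).const_add u
  simpa [Function.comp_def] using h.hasFDerivAt.comp_hasDerivAt t hline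

/-- The gradient inequality for convex functions. -/
theorem ConvexOn.add_inner_gradient_le {F : X → ℝ} (hF : ConvexOn ℝ Set.univ F) {g u : X}
    (hg : HasGradientAt F g u) (v : X) : F u + ⟪g, v⟫ ≤ F (u + v) := by
  have hconv : ConvexOn ℝ Set.univ (fun s : ℝ => F (u + s • v)) := by
    have h := hF.comp_affineMap (AffineMap.lineMap u (u + v) : ℝ →ᵃ[ℝ] X)
    simpa [Function.comp_def, AffineMap.lineMap_apply, add_comm] using h
  have hder : HasDerivAt (fun s : ℝ => F (u + s • v)) ⟪g, v⟫ 0 :=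
    HasGradientAt.hasDerivAt_comp_add_smul (by simpa using hg)
  have h := hconv.le_slope_of_hasDerivAt (Set.mem_univ 0) (Set.mem_univ 1) one_pos hder
  simp [slope_def_field] at h
  linarith

/-- The descent lemma for functions with Lipschitz continuous gradient. -/
theorem le_add_inner_gradient_add_sq {F : X → ℝ} {F' : X → X} {L : ℝ}
    (hgrad : ∀ u : X, HasGradientAt F (F' u) u)
    (hlip : ∀ u v : X, ‖F' u - F' v‖ ≤ L * ‖u - v‖) (u v : X) :
    F (u + v) ≤ F u + ⟪F' u, v⟫ + L / 2 * ‖v‖ ^ 2 := by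
  have hder : ∀ t : ℝ, HasDerivAt (fun s : ℝ => F (u + s • v)) ⟪F' (u + t • v), v⟫ t :=
    fun t => (hgrad _).hasDerivAt_comp_add_smul
  have hbound : ∀ t : ℝ,
      HasDerivAt (fun s : ℝ => F u + s * ⟪F' u, v⟫ + s ^ 2 * (L / 2 * ‖v‖ ^ 2))
        (⟪F' u, v⟫ + 2 * t * (L / 2 * ‖v‖ ^ 2)) t := by
    intro t
    have h₁ := ((hasDerivAt_id t).mul_const ⟪F' u, v⟫).const_add (F u)
    have h₂ := ((hasDerivAt_id t).pow 2).mul_const (L / 2 * ‖v‖ ^ 2)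
    simpa [Pi.add_def] using h₁.add h₂
  have h := image_le_of_deriv_right_le_deriv_boundary (a := 0) (b := 1)
    (fun t _ => (hder t).continuousAt.continuousWithinAt)
    (fun t _ => (hder t).hasDerivWithinAt) (by simp)
    (fun t _ => (hbound t).continuousAt.continuousWithinAt)
    (fun t _ => (hbound t).hasDerivWithinAt)
    (fun t ht => by
      have hcs := real_inner_le_norm (F' (u + t • v) - F' u) v
      have hL := hlip (u + t • v) u
      rw [add_sub_cancel_left, norm_smul, Real.norm_eq_abs, abs_of_nonneg ht.1] at hL
      rw [inner_sub_left] at hcs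
      nlinarith [mul_le_mul_of_nonneg_right hL (norm_nonneg v)])
    (Set.right_mem_Icc.2 zero_le_one)
  simpa using h

/-- A positive self-adjoint operator with quadratic form bounded by `M` satisfies
`‖T w‖² ≤ M ⟪T w, w⟫`. -/
theorem norm_sq_apply_le_mul_inner {E : Type*} [NormedAddCommGroup E] [InnerProductSpace ℝ E]
    {T : E →L[ℝ] E} {M : ℝ} (hM : 0 < M)
    (hsa : ∀ u v : E, ⟪T u, v⟫ = ⟪u, T v⟫) (hpos : ∀ u : E, 0 ≤ ⟪T u, u⟫)
    (hle : ∀ u : E, ⟪T u, u⟫ ≤ M * ‖u‖ ^ 2) (w : E) :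
    ‖T w‖ ^ 2 ≤ M * ⟪T w, w⟫ := by
  have h := hpos (M • w - T w)
  have hb := hle (T w)
  have hs : ⟪T (T w), w⟫ = ‖T w‖ ^ 2 := by rw [hsa, real_inner_self_eq_norm_sq]
  simp only [map_sub, map_smul, inner_sub_left, inner_sub_right, real_inner_smul_left,
    real_inner_smul_right, real_inner_self_eq_norm_sq, hs] at h
  nlinarith [h, hb]

/-- Difference of two values of a symmetric quadratic form. -/
theorem inner_apply_self_sub_inner_apply_self {E : Type*} [NormedAddCommGroup E] [InnerProductSpace ℝ E]
    {S : E →L[ℝ] E}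
    (hS : ∀ u v : E, ⟪S u, v⟫ = ⟪u, S v⟫) (a b : E) :
    ⟪S a, a⟫ - ⟪S b, b⟫ = 2 * ⟪S (a - b), a⟫ - ⟪S (a - b), a - b⟫ := by
  have h : ⟪S a, b⟫ = ⟪S b, a⟫ := by rw [hS, real_inner_comm]
  simp only [map_sub, inner_sub_left, inner_sub_right, h]
  ring

/-- The inverse of a symmetric operator is symmetric. -/
theorem inner_apply_left_eq_right_of_inverse {E : Type*} [NormedAddCommGroup E] [InnerProductSpace ℝ E]
    {S Sinv : E →L[ℝ] E}
    (hS : ∀ u v : E, ⟪S u, v⟫ = ⟪u, S v⟫) (hinv : ∀ u, S (Sinv u) = u) (u v : E) :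
    ⟪Sinv u, v⟫ = ⟪u, Sinv v⟫ := by
  rw [← hinv v, ← hS, hinv, hinv]

theorem EReal.add_coe_le_add_coe {p q : EReal} {r s a b : ℝ} (h : p + (r : EReal) ≤ q)
    (hab : a + b ≤ r + s) : p + (a : EReal) + (b : EReal) ≤ q + (s : EReal) := by
  calc p + (a : EReal) + (b : EReal) = p + ((a + b : ℝ) : EReal) := by
        rw [add_assoc, EReal.coe_add]
    _ ≤ p + ((r + s : ℝ) : EReal) := by gcongr
    _ = p + (r : EReal) + (s : EReal) := by rw [EReal.coe_add, add_assoc]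
    _ ≤ q + (s : EReal) := by gcongr

/-- One-step estimate for the inexact preconditioned primal–dual iterates:
for all `(x, y)` and `k`,
`V(z_{k+1} - z) - V(z_k - z) + ((1 - τ_M L)/(2 τ_M))‖x_{k+1} - x_k‖² + ½‖y_{k+1} - y_k‖_Σ²
 + [L_{b^δ}(x_{k+1}, y) - L_{b^δ}(x, y_{k+1})] + ⟪y_{k+1} - ỹ_k, A(x - x_{k+1})⟫ ≤ ε_{k+1}`
(with the real terms gathered on the left of the `EReal` inequality). -/
theorem statement_12
    (A : X →L[ℝ] Y) (bδ : Y)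
    (R : X → EReal) (hR : ProperConvexLsc R)
    (F : X → ℝ) (F' : X → X) (L : ℝ) (hL : 0 ≤ L)
    (hFconv : ConvexOn ℝ Set.univ F)
    (hFgrad : ∀ u : X, HasGradientAt F (F' u) u)
    (hFlip : ∀ u v : X, ‖F' u - F' v‖ ≤ L * ‖u - v‖)
    (T Tinv : X →L[ℝ] X) (Sg Sginv : Y →L[ℝ] Y)
    (hTinv : ∀ u, Tinv (T u) = u) (hTinv' : ∀ u, T (Tinv u) = u)
    (hSginv : ∀ v, Sginv (Sg v) = v) (hSginv' : ∀ v, Sg (Sginv v) = v)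
    (hTsa : ∀ u v : X, ⟪T u, v⟫ = ⟪u, T v⟫)
    (hSgsa : ∀ u v : Y, ⟪Sg u, v⟫ = ⟪u, Sg v⟫)
    (τm τM σm σM : ℝ) (hτm : 0 < τm) (hττ : τm ≤ τM) (hσm : 0 < σm) (hσσ : σm ≤ σM)
    (hTb : ∀ u : X, τm * ‖u‖ ^ 2 ≤ ⟪T u, u⟫ ∧ ⟪T u, u⟫ ≤ τM * ‖u‖ ^ 2)
    (hSgb : ∀ v : Y, σm * ‖v‖ ^ 2 ≤ ⟪Sg v, v⟫ ∧ ⟪Sg v, v⟫ ≤ σM * ‖v‖ ^ 2)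
    (ε : ℕ → ℝ) (hε : ∀ k, 0 ≤ ε k)
    (x : ℕ → X) (y : ℕ → Y) (ym1 : Y)
    (hstep : ∀ k : ℕ,
      -(Tinv (x (k + 1) - x k)) - F' (x k)
          - ContinuousLinearMap.adjoint A ((2 : ℝ) • y k - (if k = 0 then ym1 else y (k - 1)))
        ∈ epsSubdiff R (ε (k + 1)) (x (k + 1)))
    (hdual : ∀ k : ℕ, y (k + 1) = y k + Sg (A (x (k + 1)) - bδ)) :
    ∀ px : X, ∀ py : Y, ∀ k : ℕ,
      Lag R F A bδ (x (k + 1)) py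
          + ((Vfun Tinv Sginv (x (k + 1) - px, y (k + 1) - py)
              - Vfun Tinv Sginv (x k - px, y k - py)
              + (1 - τM * L) / (2 * τM) * ‖x (k + 1) - x k‖ ^ 2
              + 1 / 2 * ⟪Sginv (y (k + 1) - y k), y (k + 1) - y k⟫
              + ⟪y (k + 1) - ((2 : ℝ) • y k - (if k = 0 then ym1 else y (k - 1))),
                  A (px - x (k + 1))⟫
              - ε (k + 1) : ℝ) : EReal)
        ≤ Lag R F A bδ px (y (k + 1)) := by
  intro px py k
  generalize hyt : (2 : ℝ) • y k - (if k = 0 then ym1 else y (k - 1)) = yt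
  have hsub := hstep k px
  rw [hyt] at hsub
  refine EReal.add_coe_le_add_coe hsub ?_
  have hτM : 0 < τM := hτm.trans_le hττ
  have hdesc := le_add_inner_gradient_add_sq hFgrad hFlip (x k) (x (k + 1) - x k)
  have hgrad := hFconv.add_inner_gradient_le (hFgrad (x k)) (px - x k)
  rw [add_sub_cancel] at hdesc hgrad
  have hinner : 1 / τM * ‖x (k + 1) - x k‖ ^ 2
      ≤ ⟪Tinv (x (k + 1) - x k), x (k + 1) - x k⟫ := by
    have h := norm_sq_apply_le_mul_inner hτM hTsa
      (fun u => le_trans (by positivity) (hTb u).1) (fun u => (hTb u).2)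
      (Tinv (x (k + 1) - x k))
    rw [hTinv', real_inner_comm] at h
    rw [one_div, inv_mul_le_iff₀ hτM]
    exact h
  have hcoef : (1 - τM * L) / (2 * τM) = 1 / 2 * (1 / τM) - L / 2 := by
    field_simp
  have hVx := inner_apply_self_sub_inner_apply_self
    (inner_apply_left_eq_right_of_inverse hTsa hTinv') (x (k + 1) - px) (x k - px)
  have hVy := inner_apply_self_sub_inner_apply_self
    (inner_apply_left_eq_right_of_inverse hSgsa hSginv') (y (k + 1) - py) (y k - py)
  rw [sub_sub_sub_cancel_right] at hVx hVy
  have hres : Sginv (y (k + 1) - y k) = A (x (k + 1)) - bδ := by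
    rw [hdual, add_sub_cancel_left, hSginv]
  rw [hres] at hVy
  rw [hres, hcoef]
  simp only [Vfun]
  generalize Tinv (x (k + 1) - x k) = w at hVx hinner ⊢
  simp only [inner_sub_left, inner_sub_right, inner_neg_left,
    ContinuousLinearMap.adjoint_inner_left, map_sub] at *
  simp only [real_inner_comm _ (A (x (k + 1))), real_inner_comm _ bδ] at *
  linarith
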